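/- arXiv:2604.20877 — 4 statements merged into one kernel-verified Lean document; each statement's English description precedes it below -/
import Mathlib

section
/- Let P₀ and P₁ be probability measures on a measurable space 𝒳 with P₁ ≪ P₀, let L = dP₁/dP₀, and suppose Λ_avail := essSup_{P₀} L < ∞. Fix π ∈ (0,1) and τ ∈ (0,1), and suppose Λ_req(τ, π) := (τ/(1 − τ)) · ((1 − π)/π) > Λ_avail. Then every measurable set A with π·P₁(A) + (1 − π)·P₀(A) > 0 satisfies P₀(A) > 0 and π·P₁(A) / (π·P₁(A) + (1 − π)·P₀(A)) ≤ π·Λ_avail / (π·Λ_avail + (1 − π)) < τ. -/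
open MeasureTheory ENNReal

/-- The measure of a set is at most the essential supremum of the density times the base measure. -/
lemma measure_le_essSup_rnDeriv_mul {α : Type*} [MeasurableSpace α] {μ ν : Measure α}
    [SigmaFinite μ] [SigmaFinite ν] (hμν : μ ≪ ν) (s : Set α) :
    μ s ≤ essSup (μ.rnDeriv ν) ν * ν s := by
  rw [← Measure.setLIntegral_rnDeriv hμν s, ← setLIntegral_const]
  exact lintegral_mono_ae (ae_restrict_of_ae (ENNReal.ae_le_essSup _))

/-- **Theorem 3 (Impossibility).**
If `Λ_avail := essSup_{P₀} (dP₁/dP₀) < ∞` and the required discrimination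
`Λ_req(τ,π) = (τ/(1−τ))·((1−π)/π)` exceeds `Λ_avail`, then every admissible
decision rule `A` (i.e. `π·P₁(A) + (1−π)·P₀(A) > 0`) has `P₀ A > 0` and
`PPV(A) ≤ π·Λ_avail/(π·Λ_avail + (1−π)) < τ`. -/
theorem stmt6 {𝒳 : Type*} [MeasurableSpace 𝒳] (P₀ P₁ : Measure 𝒳)
    [IsProbabilityMeasure P₀] [IsProbabilityMeasure P₁] (habs : P₁ ≪ P₀)
    (hfin : essSup (P₁.rnDeriv P₀) P₀ ≠ ⊤)
    (π τ : ℝ) (hπ : π ∈ Set.Ioo (0 : ℝ) 1) (hτ : τ ∈ Set.Ioo (0 : ℝ) 1)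
    (hgap : (τ / (1 - τ)) * ((1 - π) / π) > (essSup (P₁.rnDeriv P₀) P₀).toReal) :
    ∀ A : Set 𝒳, MeasurableSet A →
      0 < π * (P₁ A).toReal + (1 - π) * (P₀ A).toReal →
      0 < P₀ A ∧
      π * (P₁ A).toReal / (π * (P₁ A).toReal + (1 - π) * (P₀ A).toReal) ≤
        π * (essSup (P₁.rnDeriv P₀) P₀).toReal /
          (π * (essSup (P₁.rnDeriv P₀) P₀).toReal + (1 - π)) ∧
      π * (essSup (P₁.rnDeriv P₀) P₀).toReal /
          (π * (essSup (P₁.rnDeriv P₀) P₀).toReal + (1 - π)) < τ := by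
  obtain ⟨hπ0, hπ1⟩ := hπ
  obtain ⟨hτ0, hτ1⟩ := hτ
  intro A _ hadm
  have hπ' : 0 < 1 - π := sub_pos.2 hπ1
  have hτ' : 0 < 1 - τ := sub_pos.2 hτ1
  have hpos : 0 < P₀ A := by
    rw [pos_iff_ne_zero]
    intro h
    simp [h, habs h] at hadm
  have hle : (P₁ A).toReal ≤ (essSup (P₁.rnDeriv P₀) P₀).toReal * (P₀ A).toReal := by
    rw [← ENNReal.toReal_mul]
    exact ENNReal.toReal_mono (ENNReal.mul_ne_top hfin (measure_ne_top P₀ A))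
      (measure_le_essSup_rnDeriv_mul habs A)
  have hΛ : 0 ≤ (essSup (P₁.rnDeriv P₀) P₀).toReal := ENNReal.toReal_nonneg
  generalize (essSup (P₁.rnDeriv P₀) P₀).toReal = Λ at *
  have hden : 0 < π * Λ + (1 - π) := by positivity
  refine ⟨hpos, ?_, ?_⟩
  · rw [div_le_div_iff₀ hadm hden]
    have := mul_le_mul_of_nonneg_left hle (mul_pos hπ0 hπ').le
    linarith
  · rw [gt_iff_lt, div_mul_div_comm, lt_div_iff₀ (mul_pos hτ' hπ0)] at hgap
    rw [div_lt_iff₀ hden]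
    linarith
end

section
/- Let P₀ and P₁ be probability measures on a measurable space 𝒳 with P₁ ≪ P₀, let L = dP₁/dP₀, and suppose Λ_avail := essSup_{P₀} L < ∞. Fix π ∈ (0,1). Then the supremum of π·P₁(A) / (π·P₁(A) + (1 − π)·P₀(A)) over all measurable sets A with π·P₁(A) + (1 − π)·P₀(A) > 0 equals π·Λ_avail / (π·Λ_avail + (1 − π)). -/
open MeasureTheory ENNReal

namespace MeasureTheory.Measure

variable {α : Type*} {m : MeasurableSpace α}

/-- An absolutely continuous measure is dominated by the reference measure times the essential
supremum of its density. -/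
theorem apply_le_essSup_rnDeriv_mul {μ ν : Measure α} [HaveLebesgueDecomposition ν μ]
    [SFinite μ] (h : ν ≪ μ) (s : Set α) :
    ν s ≤ essSup (ν.rnDeriv μ) μ * μ s := by
  have hs : ∫⁻ x in s, ν.rnDeriv μ x ∂μ = ν s := setLIntegral_rnDeriv h s
  calc ν s = ∫⁻ x in s, ν.rnDeriv μ x ∂μ := hs.symm
    _ ≤ ∫⁻ _ in s, essSup (ν.rnDeriv μ) μ ∂μ :=
        lintegral_mono_ae (ae_restrict_of_ae (ENNReal.ae_le_essSup _))
    _ = essSup (ν.rnDeriv μ) μ * μ s := setLIntegral_const _ _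

/-- Any level below the essential supremum of the density is attained, on average, on a
measurable set of positive measure. -/
theorem exists_measurableSet_mul_le_of_lt_essSup_rnDeriv {μ ν : Measure α} {c : ℝ≥0∞}
    (hc : c < essSup (ν.rnDeriv μ) μ) :
    ∃ s, MeasurableSet s ∧ μ s ≠ 0 ∧ c * μ s ≤ ν s := by
  have hs : MeasurableSet {x | c < ν.rnDeriv μ x} :=
    measurableSet_lt measurable_const (measurable_rnDeriv ν μ)
  refine ⟨_, hs, fun h0 => hc.not_ge (essSup_le_of_ae_le c ?_), ?_⟩
  · simpa [Filter.EventuallyLE, ae_iff] using h0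
  · rw [← setLIntegral_const]
    exact (setLIntegral_mono (measurable_rnDeriv ν μ) fun _ hx => le_of_lt hx).trans
      (setLIntegral_rnDeriv_le _)

end MeasureTheory.Measure

/-- **Theorem 3 (Impossibility), supremum identity.**
If `Λ_avail := essSup_{P₀} (dP₁/dP₀) < ∞`, then for `π ∈ (0,1)` the supremum
of `PPV(A) = π·P₁(A)/(π·P₁(A) + (1−π)·P₀(A))` over all admissible measurable
sets `A` equals `π·Λ_avail/(π·Λ_avail + (1−π))`. -/
theorem stmt7 {𝒳 : Type*} [MeasurableSpace 𝒳] (P₀ P₁ : Measure 𝒳)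
    [IsProbabilityMeasure P₀] [IsProbabilityMeasure P₁] (habs : P₁ ≪ P₀)
    (hfin : essSup (P₁.rnDeriv P₀) P₀ ≠ ⊤)
    (π : ℝ) (hπ : π ∈ Set.Ioo (0 : ℝ) 1) :
    sSup {r : ℝ | ∃ A : Set 𝒳, MeasurableSet A ∧
        0 < π * (P₁ A).toReal + (1 - π) * (P₀ A).toReal ∧
        r = π * (P₁ A).toReal / (π * (P₁ A).toReal + (1 - π) * (P₀ A).toReal)} =
      π * (essSup (P₁.rnDeriv P₀) P₀).toReal /
        (π * (essSup (P₁.rnDeriv P₀) P₀).toReal + (1 - π)) := by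
  obtain ⟨hπ0, hπ1⟩ := hπ
  have hπ' : 0 < 1 - π := sub_pos.2 hπ1
  have hle (A : Set 𝒳) :
      (P₁ A).toReal ≤ (essSup (P₁.rnDeriv P₀) P₀).toReal * (P₀ A).toReal := by
    rw [← toReal_mul]
    exact toReal_mono (mul_ne_top hfin (measure_ne_top _ _))
      (Measure.apply_le_essSup_rnDeriv_mul habs A)
  have hex (c : ℝ) (hc : 0 ≤ c) (hlt : c < (essSup (P₁.rnDeriv P₀) P₀).toReal) :
      ∃ A, MeasurableSet A ∧ 0 < (P₀ A).toReal ∧ c * (P₀ A).toReal ≤ (P₁ A).toReal := by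
    obtain ⟨A, hA, h0, h⟩ := Measure.exists_measurableSet_mul_le_of_lt_essSup_rnDeriv
      ((ofReal_lt_iff_lt_toReal hc hfin).2 hlt)
    refine ⟨A, hA, toReal_pos h0 (measure_ne_top _ _), ?_⟩
    simpa [toReal_mul, hc] using toReal_mono (measure_ne_top _ _) h
  have hΛ : 0 < (essSup (P₁.rnDeriv P₀) P₀).toReal := by
    have := hle Set.univ
    simp only [measure_univ, toReal_one, mul_one] at this
    linarith
  generalize (essSup (P₁.rnDeriv P₀) P₀).toReal = l at hle hex hΛ ⊢
  have hden : 0 < π * l + (1 - π) := by positivity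
  refine IsLUB.csSup_eq ⟨?_, fun b hb => ?_⟩ ⟨_, Set.univ, MeasurableSet.univ, by simp, rfl⟩
  · rintro _ ⟨A, -, hpos, rfl⟩
    rw [div_le_div_iff₀ hpos hden]
    nlinarith [mul_le_mul_of_nonneg_left (hle A) (mul_pos hπ0 hπ').le]
  · by_contra! hlt
    rw [lt_div_iff₀ hden] at hlt
    have hb1 : 0 < 1 - b := by
      by_contra! h
      nlinarith [mul_nonneg (sub_nonneg.2 (sub_nonpos.1 h)) hden.le]
    have hlt' : b * (1 - π) / (π * (1 - b)) < l := by
      rw [div_lt_iff₀ (by positivity)]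
      linarith
    obtain ⟨c, hc, hcl⟩ := exists_between (max_lt hlt' hΛ)
    obtain ⟨hbc, hc0⟩ := max_lt_iff.1 hc
    rw [div_lt_iff₀ (by positivity)] at hbc
    obtain ⟨A, hA, hA0, hcA⟩ := hex c hc0.le hcl
    have hpos : 0 < π * (P₁ A).toReal + (1 - π) * (P₀ A).toReal := by positivity
    have hbA := hb ⟨A, hA, hpos, rfl⟩
    rw [div_le_iff₀ hpos] at hbA
    nlinarith [mul_le_mul_of_nonneg_left hcA (mul_pos hπ0 hb1).le,
      mul_lt_mul_of_pos_right hbc hA0]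
end

section
/- Let P₀ and P₁ be probability measures on a measurable space 𝒳 with P₁ ≪ P₀, and let g : 𝒳 → 𝒴 be a measurable map into a measurable space 𝒴. Then essSup_{g_*P₀} ( d(g_*P₁)/d(g_*P₀) ) ≤ essSup_{P₀} ( dP₁/dP₀ ). -/
open MeasureTheory ENNReal

/-- **Proposition 2 (Structural Transformation Bound), conclusion.**
For probability measures `P₁ ≪ P₀` on `𝒳` and a measurable map `g : 𝒳 → 𝒴`,
the essential supremum of the pushforward likelihood ratio is bounded by that
of the original: `essSup_{g_*P₀} d(g_*P₁)/d(g_*P₀) ≤ essSup_{P₀} dP₁/dP₀`. -/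
theorem stmt10 {𝒳 𝒴 : Type*} [MeasurableSpace 𝒳] [MeasurableSpace 𝒴]
    (P₀ P₁ : Measure 𝒳) [IsProbabilityMeasure P₀] [IsProbabilityMeasure P₁]
    (habs : P₁ ≪ P₀) {g : 𝒳 → 𝒴} (hg : Measurable g) :
    essSup ((P₁.map g).rnDeriv (P₀.map g)) (P₀.map g) ≤
      essSup (P₁.rnDeriv P₀) P₀ := by
  have := Measure.isProbabilityMeasure_map (μ := P₀) hg.aemeasurable
  have := Measure.isProbabilityMeasure_map (μ := P₁) hg.aemeasurable
  refine essSup_le_of_ae_le _ (ae_le_of_forall_setLIntegral_le_of_sigmaFinite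
    (Measure.measurable_rnDeriv _ _) fun s hs _ ↦ ?_)
  calc ∫⁻ y in s, (P₁.map g).rnDeriv (P₀.map g) y ∂(P₀.map g)
      ≤ P₁.map g s := Measure.setLIntegral_rnDeriv_le s
    _ = P₁ (g ⁻¹' s) := Measure.map_apply hg hs
    _ = ∫⁻ x in g ⁻¹' s, P₁.rnDeriv P₀ x ∂P₀ := (Measure.setLIntegral_rnDeriv habs _).symm
    _ ≤ ∫⁻ _ in g ⁻¹' s, essSup (P₁.rnDeriv P₀) P₀ ∂P₀ :=
        lintegral_mono_ae (ae_restrict_of_ae (ENNReal.ae_le_essSup _))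
    _ = ∫⁻ _ in s, essSup (P₁.rnDeriv P₀) P₀ ∂(P₀.map g) := by
        rw [setLIntegral_const, setLIntegral_const, Measure.map_apply hg hs]
end

section
/- Let Q be a Borel probability measure on the interval [0,1] with moments μ_m := ∫ x^m dQ(x) for m = 1, …, M, and suppose μ₁ < 1. Then for every ε > 0 there exist Borel probability measures D₁ and D₂ on [0,1] such that |∫ x^m dD_i(x) − μ_m| ≤ ε for every i ∈ {1,2} and every m ∈ {1, …, M}, and such that the ratio (∫ x^r dD₂(x)) / (∫ x^r dD₁(x)) tends to infinity as r → ∞ (in particular ∫ x^r dD₁(x) > 0 for all r). -/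
open MeasureTheory Filter

theorem integrable_pow_of_Icc_compl_null (D : Measure ℝ) [IsFiniteMeasure D]
    (hD : D (Set.Icc (0 : ℝ) 1)ᶜ = 0) (r : ℕ) : Integrable (fun x : ℝ => x ^ r) D := by
  have hae : ∀ᵐ x ∂D, x ∈ Set.Icc (0 : ℝ) 1 := hD
  refine Integrable.of_bound (by fun_prop) 1 ?_
  filter_upwards [hae] with x hx
  rw [Real.norm_of_nonneg (pow_nonneg hx.1 r)]
  exact pow_le_one₀ hx.1 hx.2

theorem abs_pow_sub_pow_le_nat_mul {x y : ℝ} (hx : x ∈ Set.Icc (0 : ℝ) 1)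
    (hy : y ∈ Set.Icc (0 : ℝ) 1) (m : ℕ) : |x ^ m - y ^ m| ≤ m * |x - y| := by
  induction m with
  | zero => simp
  | succ k ih =>
    have hsplit : x ^ (k + 1) - y ^ (k + 1) = x * (x ^ k - y ^ k) + (x - y) * y ^ k := by ring
    have h1 : |x * (x ^ k - y ^ k)| ≤ |x ^ k - y ^ k| := by
      rw [abs_mul, abs_of_nonneg hx.1]
      exact mul_le_of_le_one_left (abs_nonneg _) hx.2
    have h2 : |(x - y) * y ^ k| ≤ |x - y| := by
      rw [abs_mul, abs_of_nonneg (pow_nonneg hy.1 k)]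
      exact mul_le_of_le_one_right (abs_nonneg _) (pow_le_one₀ hy.1 hy.2)
    rw [hsplit]
    push_cast
    linarith [abs_add_le (x * (x ^ k - y ^ k)) ((x - y) * y ^ k)]

/-- Contracting `Q` towards `1 / 2` bounds its support away from `0` and `1` while moving the
low moments only slightly. -/
theorem exists_moments_close_of_Icc_away (Q : Measure ℝ) [IsProbabilityMeasure Q]
    (hQ : Q (Set.Icc (0 : ℝ) 1)ᶜ = 0) {δ : ℝ} (hδ : 0 < δ) (hδ1 : δ ≤ 1) :
    ∃ D : Measure ℝ, IsProbabilityMeasure D ∧ D (Set.Icc (0 : ℝ) 1)ᶜ = 0 ∧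
      (∀ m : ℕ, |(∫ x, x ^ m ∂D) - ∫ x, x ^ m ∂Q| ≤ m * δ) ∧
      (∀ r : ℕ, 0 < ∫ x, x ^ r ∂D) ∧ ∀ r : ℕ, ∫ x, x ^ r ∂D ≤ (1 - δ / 2) ^ r := by
  have hae : ∀ᵐ x ∂Q, x ∈ Set.Icc (0 : ℝ) 1 := hQ
  set f : ℝ → ℝ := fun x => (1 - δ) * x + δ / 2 with hf
  have hfm : Measurable f := by fun_prop
  have hfl : ∀ x ∈ Set.Icc (0 : ℝ) 1, δ / 2 ≤ f x := fun x hx => by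
    have := mul_nonneg (sub_nonneg.2 hδ1) hx.1
    simp only [hf]; linarith
  have hfu : ∀ x ∈ Set.Icc (0 : ℝ) 1, f x ≤ 1 - δ / 2 := fun x hx => by
    have := mul_le_of_le_one_right (sub_nonneg.2 hδ1) hx.2
    simp only [hf]; linarith
  have hfI : ∀ x ∈ Set.Icc (0 : ℝ) 1, f x ∈ Set.Icc (0 : ℝ) 1 := fun x hx =>
    ⟨by linarith [hfl x hx], by linarith [hfu x hx]⟩
  have hmap : ∀ r : ℕ, ∫ x, x ^ r ∂(Q.map f) = ∫ x, f x ^ r ∂Q := fun r =>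
    integral_map hfm.aemeasurable (by fun_prop)
  have hD : IsProbabilityMeasure (Q.map f) := Measure.isProbabilityMeasure_map hfm.aemeasurable
  have hD0 : (Q.map f) (Set.Icc (0 : ℝ) 1)ᶜ = 0 := by
    rw [Measure.map_apply hfm measurableSet_Icc.compl]
    exact measure_mono_null (fun x hx hx' => hx (hfI x hx')) hQ
  have hint : ∀ r : ℕ, Integrable (fun x => f x ^ r) Q := fun r =>
    (integrable_pow_of_Icc_compl_null _ hD0 r).comp_measurable hfm
  refine ⟨Q.map f, hD, hD0, fun m => ?_, fun r => ?_, fun r => ?_⟩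
  · rw [hmap, ← integral_sub (hint m) (integrable_pow_of_Icc_compl_null Q hQ m),
      ← Real.norm_eq_abs]
    refine (norm_integral_le_of_norm_le_const (C := m * δ) ?_).trans (by simp)
    filter_upwards [hae] with x hx
    refine (abs_pow_sub_pow_le_nat_mul (hfI x hx) hx m).trans ?_
    gcongr
    rw [abs_le]
    simp only [hf]
    constructor <;> nlinarith [hx.1, hx.2]
  · rw [hmap]
    have h : ∫ _, (δ / 2) ^ r ∂Q ≤ ∫ x, f x ^ r ∂Q := by
      refine integral_mono_ae (integrable_const _) (hint r) ?_
      filter_upwards [hae] with x hx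
      exact pow_le_pow_left₀ (by positivity) (hfl x hx) r
    have hpos : 0 < (δ / 2) ^ r := by positivity
    simp only [integral_const, probReal_univ, one_smul] at h
    linarith
  · rw [hmap]
    have h : ∫ x, f x ^ r ∂Q ≤ ∫ _, (1 - δ / 2) ^ r ∂Q := by
      refine integral_mono_ae (hint r) (integrable_const _) ?_
      filter_upwards [hae] with x hx
      exact pow_le_pow_left₀ (hfI x hx).1 (hfu x hx) r
    simpa using h

/-- Mixing a small atom at `1` into `Q` keeps every moment above a positive constant. -/
theorem exists_moments_close_of_atom_one (Q : Measure ℝ) [IsProbabilityMeasure Q]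
    (hQ : Q (Set.Icc (0 : ℝ) 1)ᶜ = 0) {δ : ℝ} (hδ : 0 < δ) (hδ1 : δ ≤ 1) :
    ∃ D : Measure ℝ, IsProbabilityMeasure D ∧ D (Set.Icc (0 : ℝ) 1)ᶜ = 0 ∧
      (∀ m : ℕ, |(∫ x, x ^ m ∂D) - ∫ x, x ^ m ∂Q| ≤ δ) ∧ ∀ r : ℕ, δ ≤ ∫ x, x ^ r ∂D := by
  have hae : ∀ᵐ x ∂Q, x ∈ Set.Icc (0 : ℝ) 1 := hQ
  have hδ' : 0 ≤ 1 - δ := sub_nonneg.2 hδ1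
  have hmom : ∀ r : ℕ,
      ∫ x, x ^ r ∂(ENNReal.ofReal (1 - δ) • Q + ENNReal.ofReal δ • Measure.dirac (1 : ℝ)) =
        (1 - δ) * (∫ x, x ^ r ∂Q) + δ := fun r => by
    rw [integral_add_measure
      ((integrable_pow_of_Icc_compl_null Q hQ r).smul_measure ENNReal.ofReal_ne_top)
      ((integrable_pow_of_Icc_compl_null (Measure.dirac 1) (by simp) r).smul_measure
        ENNReal.ofReal_ne_top), integral_smul_measure, integral_smul_measure, integral_dirac,
      ENNReal.toReal_ofReal hδ', ENNReal.toReal_ofReal hδ.le]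
    simp
  have h0 : ∀ r : ℕ, 0 ≤ ∫ x, x ^ r ∂Q := fun r => by
    refine integral_nonneg_of_ae ?_
    filter_upwards [hae] with x hx
    exact pow_nonneg hx.1 r
  have h1 : ∀ r : ℕ, ∫ x, x ^ r ∂Q ≤ 1 := fun r => by
    have h : ∫ x, x ^ r ∂Q ≤ ∫ _, (1 : ℝ) ∂Q := by
      refine integral_mono_ae (integrable_pow_of_Icc_compl_null Q hQ r) (integrable_const _) ?_
      filter_upwards [hae] with x hx
      exact pow_le_one₀ hx.1 hx.2
    simpa using h
  refine ⟨ENNReal.ofReal (1 - δ) • Q + ENNReal.ofReal δ • Measure.dirac (1 : ℝ), ⟨?_⟩, ?_,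
    fun m => ?_, fun r => ?_⟩
  · simp [← ENNReal.ofReal_add hδ' hδ.le]
  · simp [hQ]
  · rw [hmom, abs_le]
    constructor <;> nlinarith [h0 m, h1 m]
  · rw [hmom]
    linarith [mul_nonneg hδ' (h0 r)]

/-- **Theorem 4 (Moment Insufficiency).**
Let `Q` be a Borel probability measure on `[0,1]` with first moment `< 1`, and
fix `M`. For every `ε > 0` there are Borel probability measures `D₁, D₂` on
`[0,1]` whose first `M` moments each match those of `Q` within `ε`, yet the
ratio of `r`-th moments `(∫ x^r dD₂)/(∫ x^r dD₁)` tends to infinity as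
`r → ∞` (and `∫ x^r dD₁ > 0` for all `r`). -/
theorem stmt16 (Q : Measure ℝ) [IsProbabilityMeasure Q]
    (hQsupp : Q (Set.Icc (0 : ℝ) 1)ᶜ = 0) (M : ℕ)
    (hμ1 : (∫ x, x ∂Q) < 1) :
    ∀ ε : ℝ, 0 < ε →
      ∃ D₁ D₂ : Measure ℝ, IsProbabilityMeasure D₁ ∧ IsProbabilityMeasure D₂ ∧
        D₁ (Set.Icc (0 : ℝ) 1)ᶜ = 0 ∧ D₂ (Set.Icc (0 : ℝ) 1)ᶜ = 0 ∧
        (∀ m : ℕ, 1 ≤ m → m ≤ M →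
          |(∫ x, x ^ m ∂D₁) - ∫ x, x ^ m ∂Q| ≤ ε ∧
          |(∫ x, x ^ m ∂D₂) - ∫ x, x ^ m ∂Q| ≤ ε) ∧
        (∀ r : ℕ, 0 < ∫ x, x ^ r ∂D₁) ∧
        Tendsto (fun r : ℕ => (∫ x, x ^ r ∂D₂) / (∫ x, x ^ r ∂D₁)) atTop atTop := by
  intro ε hε
  obtain ⟨δ, hδ, hδ1, hδε⟩ : ∃ δ : ℝ, 0 < δ ∧ δ ≤ 1 ∧ (M + 1) * δ ≤ ε := by
    refine ⟨min 1 (ε / (M + 1)), by positivity, min_le_left _ _, ?_⟩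
    rw [← le_div_iff₀' (by positivity)]
    exact min_le_right _ _
  obtain ⟨D₁, hD₁, hs₁, hm₁, hpos, hle⟩ := exists_moments_close_of_Icc_away Q hQsupp hδ hδ1
  obtain ⟨D₂, hD₂, hs₂, hm₂, hge⟩ := exists_moments_close_of_atom_one Q hQsupp hδ hδ1
  refine ⟨D₁, D₂, hD₁, hD₂, hs₁, hs₂, fun m _ hmM => ⟨(hm₁ m).trans ?_, (hm₂ m).trans ?_⟩,
    hpos, ?_⟩
  · have : (m : ℝ) ≤ M := by exact_mod_cast hmM
    nlinarith
  · nlinarith [mul_nonneg (Nat.cast_nonneg (α := ℝ) M) hδ.le]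
  · have hq : 0 < 1 - δ / 2 := by linarith
    have hlim : Tendsto (fun r : ℕ => δ * ((1 - δ / 2)⁻¹) ^ r) atTop atTop :=
      (tendsto_pow_atTop_atTop_of_one_lt
        ((one_lt_inv₀ hq).2 (by linarith))).const_mul_atTop hδ
    refine tendsto_atTop_mono (fun r => ?_) hlim
    rw [inv_pow, ← div_eq_mul_inv]
    exact div_le_div₀ (hδ.le.trans (hge r)) (hge r) (hpos r) (hle r)
end
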